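/- Let λ be an infinite cardinal and suppose F : ∇Δ_λ → λ is canonical on λ. Then: (1) the restriction F↾Δ_λ is either injective, or of the form F(x,y) = g(x) for some injective unary g, or of the form F(x,y) = g(y) for some injective unary g, or constant; (2) the same holds for F↾∇_λ; (3) if at least one of F↾Δ_λ, F↾∇_λ is injective, then either F[Δ_λ] ∩ F[∇_λ] = ∅ or F is symmetric (F(x,y) = F(y,x) for all x ≠ y). -/

import Mathlib

open Cardinal Set

universe u v

abbrev Operation (X : Type u) : Type u := Σ n : ℕ, ((Fin (n + 1) → X) → X)

def IsClone {X : Type u} (C : Set (Operation X)) : Prop :=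
  (∀ (n : ℕ) (k : Fin (n + 1)), (⟨n, fun x => x k⟩ : Operation X) ∈ C) ∧
  (∀ (n m : ℕ) (g : (Fin (m + 1) → X) → X) (f : Fin (m + 1) → (Fin (n + 1) → X) → X),
    (⟨m, g⟩ : Operation X) ∈ C → (∀ i, (⟨n, f i⟩ : Operation X) ∈ C) →
    (⟨n, fun x => g fun i => f i x⟩ : Operation X) ∈ C)

def unaryOp {X : Type u} (f : X → X) : Operation X := ⟨0, fun x => f (x 0)⟩

def binOp {X : Type u} (g : X → X → X) : Operation X := ⟨1, fun x => g (x 0) (x 1)⟩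

def PrecompleteClone {X : Type u} (C : Set (Operation X)) : Prop :=
  IsClone C ∧ C ≠ Set.univ ∧
    ∀ D : Set (Operation X), IsClone D → C ⊆ D → D = C ∨ D = Set.univ

def cloneGen {X : Type u} (F : Set (Operation X)) : Set (Operation X) :=
  ⋂₀ {C : Set (Operation X) | IsClone C ∧ F ⊆ C}

def cl {X : Type u} (F : Set (Operation X)) : Set (Operation X) :=
  ⋂₀ {C : Set (Operation X) | IsClone C ∧ F ⊆ C ∧ ∀ f : X → X, unaryOp f ∈ C}

def Pol {X : Type u} {I : Type v} (R : Set (I → X)) : Set (Operation X) :=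
  {op | ∀ ρ : Fin (op.1 + 1) → (I → X), (∀ j, ρ j ∈ R) →
    (fun i => op.2 fun j => ρ j i) ∈ R}

def IsPairing {X : Type u} (f : X → X → X) : Prop :=
  ∀ ⦃x y x' y' : X⦄, x ≠ y → x' ≠ y' → f x y = f x' y' → x = x' ∧ y = y'

def almostUnary2 {X : Type u} (g : X × X → X) : Prop :=
  ∃ G : X → Set X, (∀ x : X, #↥(G x) < #X) ∧
    ((∀ p : X × X, g p ∈ G p.1) ∨ (∀ p : X × X, g p ∈ G p.2))

def AU2 (X : Type u) : Set (X × X → X) := {g | almostUnary2 g}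

def HeavilyBinary {X : Type u} (C : Set (Operation X)) : Prop :=
  ∃ H : X → X → X, binOp H ∈ C ∧
    (∃ b : X, #↥(Set.range fun x => H x b) = #X) ∧
    (∃ a : X, #↥(Set.range fun y => H a y) = #X)

def IsCanonicalOn {X : Type u} [LinearOrder X] (F : X → X → X) (S : Set X) : Prop :=
  ∀ a b : Fin 4 → X, (∀ i, a i ∈ S) → (∀ i, b i ∈ S) →
    (∀ i j, a i < a j ↔ b i < b j) → a 0 ≠ a 1 → a 2 ≠ a 3 →
    (F (a 0) (a 1) < F (a 2) (a 3) → F (b 0) (b 1) < F (b 2) (b 3))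

def PrColoring {X : Type u} {M : Type v} [LinearOrder X] (c : X → X → M) : Prop :=
  (∀ x y : X, c x y = c y x) ∧
  ∀ a : X → Finset X, (∀ i j : X, i ≠ j → Disjoint (a i) (a j)) →
    ∀ c₀ : M, ∃ i j : X, i < j ∧ ∀ x ∈ a i, ∀ y ∈ a j, c x y = c₀

open Classical in
noncomputable def FA {X : Type u} {M : Type v} [LinearOrder X]
    (c : X → X → M) (pr : X → X → X) (z : X) (A : Set M) (α β : X) : X :=
  if α = z ∨ β = z ∨ α = β then max α β
  else if c α β ∈ A then pr α β else z

section Canonical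

variable {X : Type u} [LinearOrder X] {F : X → X → X}

theorem IsCanonicalOn.eq_of_eq (hF : IsCanonicalOn F Set.univ) {a b : Fin 4 → X}
    (hab : ∀ i j, a i < a j ↔ b i < b j) (h01 : a 0 ≠ a 1) (h23 : a 2 ≠ a 3)
    (h : F (a 0) (a 1) = F (a 2) (a 3)) : F (b 0) (b 1) = F (b 2) (b 3) := by
  have hne : ∀ i j, a i ≠ a j → b i ≠ b j := fun i j hij => by
    rcases lt_or_gt_of_ne hij with h | h
    · exact ((hab _ _).1 h).ne
    · exact ((hab _ _).1 h).ne'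
  have hba : ∀ i j, b i < b j ↔ a i < a j := fun i j => (hab i j).symm
  have hswap : ∀ i j, (![b 2, b 3, b 0, b 1] : Fin 4 → X) i < ![b 2, b 3, b 0, b 1] j ↔
      (![a 2, a 3, a 0, a 1] : Fin 4 → X) i < ![a 2, a 3, a 0, a 1] j := by
    intro i j
    fin_cases i <;> fin_cases j <;> simp [hab]
  refine le_antisymm (not_lt.1 fun hlt => ?_) (not_lt.1 fun hlt => ?_)
  · have := hF ![b 2, b 3, b 0, b 1] ![a 2, a 3, a 0, a 1] (fun _ => trivial) (fun _ => trivial)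
      hswap (hne _ _ h23) (hne _ _ h01) hlt
    exact this.ne h.symm
  · exact (hF b a (fun _ => trivial) (fun _ => trivial) hba (hne _ _ h01) (hne _ _ h23) hlt).ne h

theorem IsCanonicalOn.swap (hF : IsCanonicalOn F Set.univ) :
    IsCanonicalOn (fun x y => F y x) Set.univ := by
  intro a b _ _ hab h01 h23 h
  refine hF ![a 1, a 0, a 3, a 2] ![b 1, b 0, b 3, b 2] (fun _ => trivial) (fun _ => trivial)
    ?_ h01.symm h23.symm h
  intro i j
  fin_cases i <;> fin_cases j <;> simp [hab]

theorem exists_nat_lt_iff_lt {ι : Type*} [Fintype ι] (a : ι → X) :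
    ∃ n : ι → ℕ, ∀ i j, a i < a j ↔ n i < n j := by
  refine ⟨fun i => (Finset.univ.filter fun k => a k < a i).card, fun i j => ?_⟩
  have mono : ∀ {i j}, a i ≤ a j → (Finset.univ.filter fun k => a k < a i) ⊆
      Finset.univ.filter fun k => a k < a j := fun h k hk => by
    simp only [Finset.mem_filter, Finset.mem_univ, true_and] at hk ⊢
    exact hk.trans_le h
  refine ⟨fun h => Finset.card_lt_card ⟨mono h.le, fun hs => ?_⟩,
    fun h => not_le.1 fun hle => h.not_ge (Finset.card_le_card (mono hle))⟩
  have := @hs i (by simpa using h)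
  simp at this

variable [Nonempty X] [NoMaxOrder X]

theorem IsCanonicalOn.eq_right (hF : IsCanonicalOn F Set.univ) {x y z w : X}
    (hxy : x ≠ y) (hzw : z ≠ w) (hyz : y ≠ z) (hyw : y ≠ w) (h : F x y = F z w) {p q q' : X}
    (hpq : p ≠ q) (hpq' : p ≠ q') (hq : x < y ↔ p < q) (hq' : x < y ↔ p < q') :
    F p q = F p q' := by
  obtain ⟨e, he⟩ := Nat.exists_strictMono X
  obtain ⟨n, hn⟩ := exists_nat_lt_iff_lt ![x, y, z, w]
  have n01 := hn 0 1
  have n10 := hn 1 0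
  have n12 := hn 1 2
  have n21 := hn 2 1
  have n13 := hn 1 3
  have n31 := hn 3 1
  simp only [Matrix.cons_val] at n01 n10 n12 n21 n13 n31
  have m01 : n 0 ≠ n 1 := by grind
  have m12 : n 1 ≠ n 2 := by grind
  have m13 : n 1 ≠ n 3 := by grind
  have key : F (e (2 * n 0)) (e (2 * n 1)) = F (e (2 * n 0)) (e (2 * n 1 + 1)) := by
    have h₁ := hF.eq_of_eq (a := ![x, y, z, w]) (b := fun i => e (2 * n i))
      (fun i j => by rw [hn, he.lt_iff_lt]; omega) hxy hzw h
    have h₂ := hF.eq_of_eq (a := ![x, y, z, w])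
      (b := ![e (2 * n 0), e (2 * n 1 + 1), e (2 * n 2), e (2 * n 3)])
      (fun i j => by
        rw [hn]
        fin_cases i <;> fin_cases j <;> simp [he.lt_iff_lt] <;> omega) hxy hzw h
    exact h₁.trans h₂.symm
  have main : ∀ {q q' : X}, q < q' → p ≠ q → p ≠ q' → (x < y ↔ p < q) → (x < y ↔ p < q') →
      F p q = F p q' := by
    intro q q' hqq' hpq hpq' hq hq'
    refine hF.eq_of_eq (a := ![e (2 * n 0), e (2 * n 1), e (2 * n 0), e (2 * n 1 + 1)])
      (b := ![p, q, p, q']) ?_ (he.injective.ne (by omega)) (he.injective.ne (by omega)) key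
    intro i j
    fin_cases i <;> fin_cases j <;> simp [he.lt_iff_lt] <;> grind
  rcases lt_trichotomy q q' with hlt | rfl | hlt
  · exact main hlt hpq hpq' hq hq'
  · rfl
  · exact (main hlt hpq' hpq hq' hq).symm

theorem IsCanonicalOn.eq_left (hF : IsCanonicalOn F Set.univ) {x y z w : X}
    (hxy : x ≠ y) (hzw : z ≠ w) (hxz : x ≠ z) (hxw : x ≠ w) (h : F x y = F z w) {p p' q : X}
    (hpq : p ≠ q) (hpq' : p' ≠ q) (hp : x < y ↔ p < q) (hp' : x < y ↔ p' < q) :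
    F p q = F p' q :=
  hF.swap.eq_right hxy.symm hzw.symm hxw hxz h hpq.symm hpq'.symm (by grind) (by grind)

theorem IsCanonicalOn.injOn_or_unary_or_const (hF : IsCanonicalOn F Set.univ) :
    Set.InjOn (fun p : X × X => F p.1 p.2) {p : X × X | p.1 < p.2} ∨
      (∃ g : X → X, Set.InjOn g {x : X | ∃ y, x < y} ∧ ∀ x y : X, x < y → F x y = g x) ∨
      (∃ g : X → X, Set.InjOn g {y : X | ∃ x, x < y} ∧ ∀ x y : X, x < y → F x y = g y) ∨
      (∃ d : X, ∀ x y : X, x < y → F x y = d) := by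
  by_cases hinj : Set.InjOn (fun p : X × X => F p.1 p.2) {p : X × X | p.1 < p.2}
  · exact Or.inl hinj
  refine Or.inr ?_
  have right : ∀ {x y z w : X}, x < y → z < w → y < w → F x y = F z w →
      ∀ ⦃p q q' : X⦄, p < q → p < q' → F p q = F p q' :=
    fun hxy hzw hyw h _ _ _ hpq hpq' =>
      hF.eq_right hzw.ne hxy.ne (hxy.trans hyw).ne' hyw.ne' h.symm hpq.ne hpq'.ne
        (by simp [*]) (by simp [*])
  have left : ∀ {x z y : X}, x < y → z < y → x < z → F x y = F z y →
      ∀ ⦃p p' q : X⦄, p < q → p' < q → F p q = F p' q :=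
    fun hxy hzw hxz h _ _ _ hpq hpq' =>
      hF.eq_left hxy.ne hzw.ne hxz.ne hxy.ne h hpq.ne hpq'.ne (by simp [*]) (by simp [*])
  have const : (∀ ⦃p q q' : X⦄, p < q → p < q' → F p q = F p q') →
      (∀ ⦃p p' q : X⦄, p < q → p' < q → F p q = F p' q) →
      ∃ d : X, ∀ x y : X, x < y → F x y = d := by
    intro hr hl
    obtain ⟨a⟩ := ‹Nonempty X›
    obtain ⟨b, hb⟩ := exists_gt a
    refine ⟨F a b, fun x y hxy => ?_⟩
    obtain ⟨m, hm⟩ := exists_gt (max x a)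
    obtain ⟨hxm, ham⟩ := max_lt_iff.1 hm
    exact (hr hxy hxm).trans ((hl hxm ham).trans (hr ham hb))
  have hcases : (∀ ⦃p q q' : X⦄, p < q → p < q' → F p q = F p q') ∨
      (∀ ⦃p p' q : X⦄, p < q → p' < q → F p q = F p' q) := by
    simp only [Set.InjOn] at hinj
    push Not at hinj
    obtain ⟨⟨x, y⟩, hxy, ⟨z, w⟩, hzw, h, hne⟩ := hinj
    simp only [Set.mem_ofPred_eq] at hxy hzw h
    rcases lt_trichotomy y w with hyw | rfl | hyw
    · exact Or.inl (right hxy hzw hyw h)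
    · rcases lt_trichotomy x z with hxz | rfl | hxz
      · exact Or.inr (left hxy hzw hxz h)
      · exact absurd rfl hne
      · exact Or.inr (left hzw hxy hxz h.symm)
    · exact Or.inl (right hzw hxy hyw h.symm)
  rcases hcases with hr | hl
  · choose s hs using fun x : X => exists_gt x
    by_cases hg : Set.InjOn (fun x => F x (s x)) {x : X | ∃ y, x < y}
    · exact Or.inl ⟨_, hg, fun x y hxy => hr hxy (hs x)⟩
    · refine Or.inr (Or.inr (const hr ?_))
      simp only [Set.InjOn] at hg
      push Not at hg
      obtain ⟨x, -, z, -, h, hne⟩ := hg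
      obtain ⟨m, hm⟩ := exists_gt (max x z)
      obtain ⟨hxm, hzm⟩ := max_lt_iff.1 hm
      have h' : F x m = F z m := (hr hxm (hs x)).trans (h.trans (hr (hs z) hzm))
      rcases lt_or_gt_of_ne hne with hlt | hlt
      · exact left hxm hzm hlt h'
      · exact left hzm hxm hlt h'.symm
  · have hs : ∀ y : X, ∃ g : X, ∀ x, x < y → F x y = g := fun y => by
      by_cases hy : ∃ x, x < y
      · obtain ⟨x, hx⟩ := hy
        exact ⟨F x y, fun x' hx' => hl hx' hx⟩
      · exact ⟨y, fun x hx => absurd ⟨x, hx⟩ hy⟩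
    choose g hg using hs
    by_cases hgi : Set.InjOn g {y : X | ∃ x, x < y}
    · exact Or.inr (Or.inl ⟨g, hgi, fun x y hxy => hg y x hxy⟩)
    · refine Or.inr (Or.inr (const ?_ hl))
      simp only [Set.InjOn] at hgi
      push Not at hgi
      obtain ⟨y, ⟨x, hxy⟩, w, ⟨z, hzw⟩, h, hne⟩ := hgi
      have h' : F x y = F z w := by rw [hg y x hxy, hg w z hzw, h]
      rcases lt_or_gt_of_ne hne with hlt | hlt
      · exact right hxy hzw hlt h'
      · exact right hzw hxy hlt h'.symm

theorem IsCanonicalOn.symmetric_of_injOn (hF : IsCanonicalOn F Set.univ)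
    (hinj : Set.InjOn (fun p : X × X => F p.1 p.2) {p : X × X | p.1 < p.2})
    {x y z w : X} (hxy : x < y) (hzw : z < w) (h : F x y = F w z) (p q : X) (hpq : p ≠ q) :
    F p q = F q p := by
  obtain ⟨e, he⟩ := Nat.exists_strictMono X
  have e01 : e 0 < e 1 := he (by simp)
  have e12 : e 1 < e 2 := he (by simp)
  have e02 : e 0 < e 2 := he (by simp)
  have hy : y = z ∨ y = w := by
    by_contra! hy
    have := hinj (x₁ := (e 0, e 1)) (x₂ := (e 0, e 2)) e01 e02
      (hF.eq_right hxy.ne hzw.ne' hy.2 hy.1 h e01.ne e02.ne (by simp [*]) (by simp [*]))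
    simp [e12.ne] at this
  have hx : x = z ∨ x = w := by
    by_contra! hx
    have := hinj (x₁ := (e 0, e 2)) (x₂ := (e 1, e 2)) e02 e12
      (hF.eq_left hxy.ne hzw.ne' hx.2 hx.1 h e02.ne e12.ne (by simp [*]) (by simp [*]))
    simp [e01.ne] at this
  obtain ⟨rfl, rfl⟩ : x = z ∧ y = w := by grind
  have main : ∀ {p q : X}, p < q → F p q = F q p := fun {p q} hlt => by
    refine hF.eq_of_eq (a := ![x, y, y, x]) (b := ![p, q, q, p]) ?_ hxy.ne hxy.ne' h
    intro i j
    fin_cases i <;> fin_cases j <;> simp [hxy, hlt, hxy.not_gt, hlt.not_gt]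
  rcases lt_or_gt_of_ne hpq with hlt | hlt
  · exact main hlt
  · exact (main hlt).symm

end Canonical

theorem noMaxOrder_of_mk_Iio_lt {X : Type u} [LinearOrder X] [Infinite X]
    (hsmall : ∀ x : X, #{y : X | y < x} < #X) : NoMaxOrder X := by
  refine ⟨fun x => ?_⟩
  by_contra! hx
  have huniv : (Set.univ : Set X) ⊆ insert x {y : X | y < x} := fun y _ => (hx y).eq_or_lt
  have hle := (mk_univ (α := X)).symm.le.trans ((mk_le_mk_of_subset huniv).trans mk_insert_le)
  exact hle.not_gt (add_lt_of_lt (aleph0_le_mk X) (hsmall x)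
    (one_lt_aleph0.trans_le (aleph0_le_mk X)))

theorem injOn_swap_iff {X : Type u} [LinearOrder X] {F : X → X → X} :
    Set.InjOn (fun p : X × X => F p.2 p.1) {p : X × X | p.1 < p.2} ↔
      Set.InjOn (fun p : X × X => F p.1 p.2) {p : X × X | p.2 < p.1} := by
  constructor <;> intro h p hp q hq hpq <;>
    simpa using congrArg Prod.swap (h (x₁ := p.swap) (x₂ := q.swap) hp hq hpq)

theorem stmt18 {X : Type u} [LinearOrder X] [WellFoundedLT X] [Infinite X]
    (hsmall : ∀ x : X, #{y : X | y < x} < #X)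
    (F : X → X → X) (hcanon : IsCanonicalOn F Set.univ) :
    (Set.InjOn (fun p : X × X => F p.1 p.2) {p : X × X | p.2 < p.1} ∨
      (∃ g : X → X, Set.InjOn g {x : X | ∃ y, y < x} ∧ ∀ x y : X, y < x → F x y = g x) ∨
      (∃ g : X → X, Set.InjOn g {y : X | ∃ x, y < x} ∧ ∀ x y : X, y < x → F x y = g y) ∨
      (∃ d : X, ∀ x y : X, y < x → F x y = d)) ∧
    (Set.InjOn (fun p : X × X => F p.1 p.2) {p : X × X | p.1 < p.2} ∨
      (∃ g : X → X, Set.InjOn g {x : X | ∃ y, x < y} ∧ ∀ x y : X, x < y → F x y = g x) ∨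
      (∃ g : X → X, Set.InjOn g {y : X | ∃ x, x < y} ∧ ∀ x y : X, x < y → F x y = g y) ∨
      (∃ d : X, ∀ x y : X, x < y → F x y = d)) ∧
    ((Set.InjOn (fun p : X × X => F p.1 p.2) {p : X × X | p.2 < p.1} ∨
        Set.InjOn (fun p : X × X => F p.1 p.2) {p : X × X | p.1 < p.2}) →
      ((fun p : X × X => F p.1 p.2) '' {p : X × X | p.2 < p.1} ∩
          (fun p : X × X => F p.1 p.2) '' {p : X × X | p.1 < p.2} = ∅ ∨
        ∀ x y : X, x ≠ y → F x y = F y x)) := by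
  have := noMaxOrder_of_mk_Iio_lt hsmall
  refine ⟨?_, hcanon.injOn_or_unary_or_const, ?_⟩
  · rcases hcanon.swap.injOn_or_unary_or_const with h | ⟨g, hg, h⟩ | ⟨g, hg, h⟩ | ⟨d, h⟩
    · exact Or.inl (injOn_swap_iff.1 h)
    · exact Or.inr (Or.inr (Or.inl ⟨g, fun x _ z _ => hg (exists_gt x) (exists_gt z),
        fun x y hxy => h y x hxy⟩))
    · exact Or.inr (Or.inl ⟨g, hg, fun x y hxy => h y x hxy⟩)
    · exact Or.inr (Or.inr (Or.inr ⟨d, fun x y hxy => h y x hxy⟩))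
  · intro hinj
    refine or_iff_not_imp_left.2 fun hne => ?_
    obtain ⟨_, ⟨⟨w, z⟩, hzw, rfl⟩, ⟨⟨x, y⟩, hxy, h⟩⟩ := Set.nonempty_iff_ne_empty.2 hne
    rcases hinj with hinj | hinj
    · exact fun p q hpq => (hcanon.swap.symmetric_of_injOn (injOn_swap_iff.2 hinj) hzw hxy
        h.symm p q hpq).symm
    · exact hcanon.symmetric_of_injOn hinj hxy hzw h
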